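/- Let T be a triangulation of a simply connected surface (possibly with boundary) in which every interior vertex has even degree. Then the vertices of T admit a proper 3-coloring, i.e., a map from vertices to {1,2,3} assigning distinct colors to the two endpoints of every edge. -/

import Mathlib

/-!
Combinatorial triangulated surfaces.

A triangulation is encoded by its finset of faces (each a 3-element finset of
vertices).  `IsClosedSurface` says: nonempty, every face a triangle, every edge
in exactly two faces, and the faces around each vertex are connected through
edges containing that vertex (so the link of every vertex is a single cycle).
A connected closed surface with Euler characteristic 2 is a sphere, with
Euler characteristic 1 is the projective plane, and an orientable one with
Euler characteristic 0 is the torus.  Surfaces with boundary allow edges lying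
in exactly one face; a connected such surface is simply connected iff it is a
disk (Euler characteristic 1, with boundary) or a sphere (Euler characteristic 2).
The degree of a vertex is the number of edges containing it.
-/

namespace Fisk

variable {V : Type*} [DecidableEq V]

/-- The edges of a triangulation: the 2-element subsets of its faces. -/
def edges (F : Finset (Finset V)) : Finset (Finset V) :=
  F.biUnion (fun f => f.powersetCard 2)

/-- The vertex set of a triangulation. -/
def vertices (F : Finset (Finset V)) : Finset V := F.sup id

/-- The degree of a vertex: the number of edges containing it. -/
def degree (F : Finset (Finset V)) (v : V) : ℕ :=
  ((edges F).filter (fun e => v ∈ e)).card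

/-- Two vertices are adjacent if they span an edge. -/
def IsAdjacent (F : Finset (Finset V)) (a b : V) : Prop :=
  a ≠ b ∧ ({a, b} : Finset V) ∈ edges F

/-- The faces are connected under the relation "share an edge". -/
def FacesConnected (F : Finset (Finset V)) : Prop :=
  ∀ f ∈ F, ∀ g ∈ F,
    Relation.ReflTransGen (fun x y => x ∈ F ∧ y ∈ F ∧ (x ∩ y).card = 2) f g

/-- Around every vertex, the faces containing it are connected through
edges containing it (links are connected). -/
def LinkConnected (F : Finset (Finset V)) : Prop :=
  ∀ v : V, ∀ f ∈ F, ∀ g ∈ F, v ∈ f → v ∈ g →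
    Relation.ReflTransGen
      (fun x y => x ∈ F ∧ y ∈ F ∧ v ∈ x ∧ v ∈ y ∧ (x ∩ y).card = 2) f g

/-- A triangulation of a closed surface. -/
def IsClosedSurface (F : Finset (Finset V)) : Prop :=
  F.Nonempty ∧ (∀ f ∈ F, f.card = 3) ∧
  (∀ e ∈ edges F, (F.filter (fun f => e ⊆ f)).card = 2) ∧
  LinkConnected F

/-- The Euler characteristic `#V - #E + #F`. -/
def eulerChar (F : Finset (Finset V)) : ℤ :=
  ((vertices F).card : ℤ) - ((edges F).card : ℤ) + (F.card : ℤ)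

/-- A triangulation of the 2-sphere: a connected closed surface with
Euler characteristic 2. -/
def IsSphere (F : Finset (Finset V)) : Prop :=
  IsClosedSurface F ∧ FacesConnected F ∧ eulerChar F = 2

/-- The oriented edges of an ordered triple. -/
def orientedEdges (t : V × V × V) : Finset (V × V) :=
  {(t.1, t.2.1), (t.2.1, t.2.2), (t.2.2, t.1)}

/-- Orientability: each face can be given a cyclic order of its vertices so
that no directed edge is induced by two different faces (i.e. adjacent faces
induce opposite orientations on their common edge). -/
def Orientable (F : Finset (Finset V)) : Prop :=
  ∃ o : Finset V → V × V × V,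
    (∀ f ∈ F, ({(o f).1, (o f).2.1, (o f).2.2} : Finset V) = f) ∧
    (∀ f ∈ F, ∀ g ∈ F, f ≠ g → ∀ p ∈ orientedEdges (o f), p ∉ orientedEdges (o g))

/-- A triangulation of the torus: a connected orientable closed surface with
Euler characteristic 0. -/
def IsTorus (F : Finset (Finset V)) : Prop :=
  IsClosedSurface F ∧ FacesConnected F ∧ Orientable F ∧ eulerChar F = 0

/-- A triangulation of the projective plane: a connected closed surface with
Euler characteristic 1. -/
def IsProjectivePlane (F : Finset (Finset V)) : Prop :=
  IsClosedSurface F ∧ FacesConnected F ∧ eulerChar F = 1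

/-- A triangulation of a surface, possibly with boundary: every edge lies in
one or two faces. -/
def IsSurfaceWithBoundary (F : Finset (Finset V)) : Prop :=
  F.Nonempty ∧ (∀ f ∈ F, f.card = 3) ∧
  (∀ e ∈ edges F,
    (F.filter (fun f => e ⊆ f)).card = 1 ∨ (F.filter (fun f => e ⊆ f)).card = 2) ∧
  LinkConnected F

/-- The boundary edges: edges lying in exactly one face. -/
def boundaryEdges (F : Finset (Finset V)) : Finset (Finset V) :=
  (edges F).filter (fun e => (F.filter (fun f => e ⊆ f)).card = 1)

/-- The boundary vertices: vertices of boundary edges. -/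
def boundaryVertices (F : Finset (Finset V)) : Finset V :=
  (boundaryEdges F).sup id

/-- A compact connected surface (possibly with boundary) is simply connected
iff it is a sphere (χ = 2) or a disk (χ = 1, nonempty boundary). -/
def IsSimplyConnectedSurface (F : Finset (Finset V)) : Prop :=
  IsSurfaceWithBoundary F ∧ FacesConnected F ∧
    (eulerChar F = 2 ∨ (eulerChar F = 1 ∧ (boundaryEdges F).Nonempty))

/-- A triangulation of a disk (= of a polygon, the corners being the boundary
vertices): a connected surface with nonempty boundary and Euler characteristic 1. -/
def IsDisk (F : Finset (Finset V)) : Prop :=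
  IsSurfaceWithBoundary F ∧ FacesConnected F ∧ eulerChar F = 1 ∧
    (boundaryEdges F).Nonempty

/-- A proper vertex coloring: the two endpoints of every edge get distinct
colors (for a triangulation: every triangle receives all three colors). -/
def ProperColoring {C : Type*} (F : Finset (Finset V)) (c : V → C) : Prop :=
  ∀ e ∈ edges F, ∀ u ∈ e, ∀ w ∈ e, u ≠ w → c u ≠ c w

lemma mem_edges {F : Finset (Finset V)} {e : Finset V} :
    e ∈ edges F ↔ ∃ f ∈ F, e ⊆ f ∧ e.card = 2 := by
  simp [edges, Finset.mem_powersetCard]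

lemma IsSurfaceWithBoundary.inter_eq {F : Finset (Finset V)} (hF : IsSurfaceWithBoundary F)
    {e f g : Finset V} (he : e.card = 2) (hf : f ∈ F) (hg : g ∈ F) (hef : e ⊆ f) (heg : e ⊆ g)
    (hfg : f ≠ g) : f ∩ g = e := by
  have hf3 := hF.2.1 f hf
  have hg3 := hF.2.1 g hg
  refine (Finset.eq_of_subset_of_card_le (Finset.subset_inter hef heg) ?_).symm
  by_contra hlt
  have h3 : f.card ≤ (f ∩ g).card := by omega
  have h1 := Finset.eq_of_subset_of_card_le Finset.inter_subset_left h3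
  have h2 := Finset.eq_of_subset_of_card_le (Finset.inter_eq_left.mp h1) (by omega)
  exact hfg h2

lemma IsSurfaceWithBoundary.ne_of_card_inter {F : Finset (Finset V)}
    (hF : IsSurfaceWithBoundary F) {f g : Finset V} (hf : f ∈ F)
    (h : (f ∩ g).card = 2) : f ≠ g := by
  rintro rfl
  have := hF.2.1 f hf
  simp at h
  omega

/-- The faces along an edge shared by two faces are exactly these two. -/
lemma IsSurfaceWithBoundary.filter_inter {F : Finset (Finset V)}
    (hF : IsSurfaceWithBoundary F) {f g : Finset V} (hf : f ∈ F) (hg : g ∈ F)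
    (h : (f ∩ g).card = 2) : F.filter (fun h => f ∩ g ⊆ h) = {f, g} := by
  have hne := hF.ne_of_card_inter hf h
  have he : f ∩ g ∈ edges F := mem_edges.2 ⟨f, hf, Finset.inter_subset_left, h⟩
  refine (Finset.eq_of_subset_of_card_le ?_ ?_).symm
  · intro x hx
    simp only [Finset.mem_insert, Finset.mem_singleton] at hx
    rcases hx with rfl | rfl
    · simp [hf]
    · simp [hg]
  · rw [Finset.card_pair hne]
    rcases hF.2.2.1 _ he with h | h <;> omega

lemma IsSurfaceWithBoundary.exists_faces {F : Finset (Finset V)}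
    (hF : IsSurfaceWithBoundary F) {e : Finset V} (he : e ∈ edges F)
    (hb : e ∉ boundaryEdges F) :
    ∃ f ∈ F, ∃ g ∈ F, f ≠ g ∧ f ∩ g = e ∧ F.filter (fun h => e ⊆ h) = {f, g} := by
  have h2 : (F.filter (fun f => e ⊆ f)).card = 2 := by
    rcases hF.2.2.1 _ he with h | h
    · exact absurd (Finset.mem_filter.2 ⟨he, h⟩) hb
    · exact h
  obtain ⟨f, g, hfg, h⟩ := Finset.card_eq_two.1 h2
  have hf : f ∈ F.filter (fun f => e ⊆ f) := by simp [h]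
  have hg : g ∈ F.filter (fun f => e ⊆ f) := by simp [h]
  rw [Finset.mem_filter] at hf hg
  obtain ⟨_, _, _, hc⟩ := mem_edges.1 he
  exact ⟨f, hf.1, g, hg.1, hfg, hF.inter_eq hc hf.1 hg.1 hf.2 hg.2 hfg, h⟩

/-- The colorings `c f` of the faces `f` along the edge `e` coincide on `e`. -/
def Agree (F : Finset (Finset V)) (c : Finset V → V → Fin 3) (e : Finset V) : Prop :=
  ∀ f ∈ F, ∀ g ∈ F, e ⊆ f → e ⊆ g → ∀ v ∈ e, c f v = c g v

lemma agree_of_mem_boundaryEdges {F : Finset (Finset V)} (c : Finset V → V → Fin 3)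
    {e : Finset V} (he : e ∈ boundaryEdges F) : Agree F c e := by
  intro f hf g hg hef heg v _
  obtain ⟨a, ha⟩ := Finset.card_eq_one.1 (Finset.mem_filter.1 he).2
  have hfa : f ∈ F.filter (fun f => e ⊆ f) := by simp [hf, hef]
  have hga : g ∈ F.filter (fun f => e ⊆ f) := by simp [hg, heg]
  rw [ha, Finset.mem_singleton] at hfa hga
  rw [hfa, hga]

lemma exists_perm_fin_three : ∀ a b a' b' : Fin 3, a ≠ b → a' ≠ b' →
    ∃ π : Equiv.Perm (Fin 3), π a = a' ∧ π b = b' := by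
  decide

lemma exists_step {α : Type*} {r : α → α → Prop} {S : α → Prop} {a b : α}
    (h : Relation.ReflTransGen r a b) (ha : S a) (hb : ¬ S b) :
    ∃ x y, r x y ∧ S x ∧ ¬ S y := by
  by_contra! hcon
  refine hb ?_
  induction h with
  | refl => exact ha
  | tail _ hr ih => exact hcon _ _ hr (by_contra fun hn => hn (ih hn))

/-- The faces can be colored one by one such that any two faces are joined by a chain of
faces whose colorings agree along common edges. -/
lemma IsSurfaceWithBoundary.exists_face_colorings {F : Finset (Finset V)}
    (hF : IsSurfaceWithBoundary F) (hconn : FacesConnected F) :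
    ∃ c : Finset V → V → Fin 3, (∀ f ∈ F, Set.InjOn (c f) f) ∧
      ∀ S : Finset V → Prop,
        (∀ f ∈ F, ∀ g ∈ F, (f ∩ g).card = 2 → Agree F c (f ∩ g) → S f → S g) →
        ∀ f ∈ F, ∀ g ∈ F, S f → S g := by
  classical
  let bad : (Finset V → V → Fin 3) → ℕ :=
    fun c => ((edges F).filter (fun e => ¬ Agree F c e)).card
  have hne : {c : Finset V → V → Fin 3 | ∀ f ∈ F, Set.InjOn (c f) f}.Nonempty := by
    have : ∀ f : Finset V, ∃ k : V → Fin 3, f ∈ F → Set.InjOn k f := by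
      intro f
      by_cases hf : f ∈ F
      · have e := f.equivFinOfCardEq (hF.2.1 f hf)
        refine ⟨fun v => if hv : v ∈ f then e ⟨v, hv⟩ else 0, fun _ u hu w hw h => ?_⟩
        have hu' : u ∈ f := hu
        have hw' : w ∈ f := hw
        simpa [hu', hw'] using h
      · exact ⟨fun _ => 0, fun h => absurd h hf⟩
    choose c hc using this
    exact ⟨c, fun f hf => hc f hf⟩
  obtain ⟨c, hc, hmin⟩ := (measure bad).wf.has_min _ hne
  refine ⟨c, hc, fun S hS f hf g hg hSf => by_contra fun hSg => ?_⟩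
  obtain ⟨x, y, ⟨hx, hy, hxy⟩, hSx, hSy⟩ := exists_step (hconn f hf g hg) hSf hSg
  obtain ⟨p, q, hpq, hpqe⟩ := Finset.card_eq_two.1 hxy
  have hp : p ∈ x ∩ y := by simp [hpqe]
  have hq : q ∈ x ∩ y := by simp [hpqe]
  rw [Finset.mem_inter] at hp hq
  obtain ⟨π, hπp, hπq⟩ := exists_perm_fin_three _ _ _ _
    ((hc x hx).ne hp.1 hq.1 hpq) ((hc y hy).ne hp.2 hq.2 hpq)
  let c' : Finset V → V → Fin 3 := fun h v => if S h then π (c h v) else c h v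
  have hc' : ∀ f ∈ F, Set.InjOn (c' f) f := by
    intro f hf u hu w hw huw
    by_cases hSf : S f
    · exact hc f hf hu hw (by simpa [c', hSf] using huw)
    · exact hc f hf hu hw (by simpa [c', hSf] using huw)
  have hcross : ∀ e ∈ edges F, Agree F c e → ∀ h ∈ F, ∀ k ∈ F, e ⊆ h → e ⊆ k → S h → S k := by
    intro e he hag h hh k hk heh hek hSh
    by_cases hhk : h = k
    · exact hhk ▸ hSh
    obtain ⟨_, _, _, he2⟩ := mem_edges.1 he
    have hi := hF.inter_eq he2 hh hk heh hek hhk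
    exact hS h hh k hk (by rw [hi, he2]) (by rwa [hi]) hSh
  refine hmin c' hc' (Finset.card_lt_card ?_)
  refine Finset.ssubset_iff_of_subset ?_ |>.2 ⟨x ∩ y, ?_, ?_⟩
  · intro e
    simp only [Finset.mem_filter]
    rintro ⟨he, hb⟩
    refine ⟨he, fun hag => hb ?_⟩
    intro h hh k hk heh hek v hv
    have h1 := hcross e he hag h hh k hk heh hek
    have h2 := hcross e he hag k hk h hh hek heh
    have h3 := hag h hh k hk heh hek v hv
    by_cases hSh : S h
    · simp [c', hSh, h1 hSh, h3]
    · have : ¬ S k := fun hk => hSh (h2 hk)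
      simp [c', hSh, this, h3]
  · refine Finset.mem_filter.2 ⟨mem_edges.2 ⟨x, hx, Finset.inter_subset_left, hxy⟩, fun hag => ?_⟩
    exact hSy (hS x hx y hy hxy hag hSx)
  · simp only [Finset.mem_filter, not_and, not_not]
    intro _
    have key : ∀ v ∈ x ∩ y, c' x v = c' y v := by
      intro v hv
      rw [hpqe, Finset.mem_insert, Finset.mem_singleton] at hv
      rcases hv with rfl | rfl <;> simp [c', hSx, hSy, hπp, hπq]
    have hfil := hF.filter_inter hx hy hxy
    intro h hh k hk heh hek v hv
    have hh' : h ∈ F.filter (fun h => x ∩ y ⊆ h) := by simp [hh, heh]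
    have hk' : k ∈ F.filter (fun h => x ∩ y ⊆ h) := by simp [hk, hek]
    rw [hfil, Finset.mem_insert, Finset.mem_singleton] at hh' hk'
    rcases hh' with rfl | rfl <;> rcases hk' with rfl | rfl <;> simp [key v hv]

lemma sum_edges_sum_faces {M : Type*} [AddCommMonoid M] (F : Finset (Finset V))
    (ψ : Finset V → Finset V → M) :
    ∑ e ∈ edges F, ∑ f ∈ F with e ⊆ f, ψ f e = ∑ f ∈ F, ∑ e ∈ f.powersetCard 2, ψ f e := by
  refine Finset.sum_comm' fun e f => ?_
  simp only [mem_edges, Finset.mem_filter, Finset.mem_powersetCard]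
  constructor
  · rintro ⟨⟨_, _, _, h⟩, hf, hef⟩
    exact ⟨⟨hef, h⟩, hf⟩
  · rintro ⟨⟨hef, h⟩, hf⟩
    exact ⟨⟨f, hf, hef, h⟩, hf, hef⟩

lemma sum_powersetCard_two {M : Type*} [AddCommMonoid M] {x y z : V} (hxy : x ≠ y) (hxz : x ≠ z)
    (hyz : y ≠ z) (ψ : Finset V → M) :
    ∑ e ∈ ({x, y, z} : Finset V).powersetCard 2, ψ e = ψ {x, y} + ψ {x, z} + ψ {y, z} := by
  have : ({x, y, z} : Finset V).powersetCard 2 = {{x, y}, {x, z}, {y, z}} := by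
    symm
    refine Finset.eq_of_subset_of_card_le ?_ ?_
    · intro e
      simp only [Finset.mem_insert, Finset.mem_singleton, Finset.mem_powersetCard]
      rintro (rfl | rfl | rfl)
      · exact ⟨by grind, Finset.card_pair hxy⟩
      · exact ⟨by grind, Finset.card_pair hxz⟩
      · exact ⟨by grind, Finset.card_pair hyz⟩
    · have h1 : ({x, y} : Finset V) ≠ {x, z} := fun h => by
        have : y ∈ ({x, z} : Finset V) := h ▸ by simp
        grind
      have h2 : ({x, y} : Finset V) ≠ {y, z} := fun h => by
        have : x ∈ ({y, z} : Finset V) := h ▸ by simp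
        grind
      have h3 : ({x, z} : Finset V) ≠ {y, z} := fun h => by
        have : x ∈ ({y, z} : Finset V) := h ▸ by simp
        grind
      have h4 : ({{x, y}, {x, z}, {y, z}} : Finset (Finset V)).card = 3 :=
        Finset.card_eq_three.2 ⟨_, _, _, h1, h2, h3, rfl⟩
      have h5 : ({x, y, z} : Finset V).card = 3 :=
        Finset.card_eq_three.2 ⟨_, _, _, hxy, hxz, hyz, rfl⟩
      rw [Finset.card_powersetCard, h4, h5]
      rfl
  rw [this, Finset.sum_insert, Finset.sum_insert, Finset.sum_singleton, add_assoc]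
  · intro h
    rw [Finset.mem_singleton] at h
    have := h ▸ Finset.mem_insert_self x {z}
    grind
  · intro h
    simp only [Finset.mem_insert, Finset.mem_singleton] at h
    rcases h with h | h
    · have : y ∈ ({x, z} : Finset V) := h ▸ by simp
      grind
    · have : x ∈ ({y, z} : Finset V) := h ▸ by simp
      grind

lemma exists_eq_insert_pair {f : Finset V} (hf : f.card = 3) {v : V} (hv : v ∈ f) :
    ∃ x y, v ≠ x ∧ v ≠ y ∧ x ≠ y ∧ f = {v, x, y} := by
  have h2 : (f.erase v).card = 2 := by rw [Finset.card_erase_of_mem hv, hf]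
  obtain ⟨x, y, hxy, h⟩ := Finset.card_eq_two.1 h2
  have hx : x ∈ f.erase v := by simp [h]
  have hy : y ∈ f.erase v := by simp [h]
  exact ⟨x, y, (Finset.ne_of_mem_erase hx).symm, (Finset.ne_of_mem_erase hy).symm, hxy, by
    rw [← h, Finset.insert_erase hv]⟩

/-- Summing a function of the flags at an interior vertex that agrees on both sides of all
edges but one leaves only the contribution of that edge. -/
lemma IsSurfaceWithBoundary.sum_star {F : Finset (Finset V)} (hF : IsSurfaceWithBoundary F)
    {v : V} (hv : v ∉ boundaryVertices F) {e f g : Finset V} (he : e ∈ edges F) (hve : v ∈ e)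
    (hfg : f ≠ g) (hfil : F.filter (fun h => e ⊆ h) = {f, g})
    (ψ : Finset V → Finset V → ZMod 2)
    (hψ : ∀ e' ∈ edges F, v ∈ e' → e' ≠ e → ∀ f ∈ F, ∀ g ∈ F, e' ⊆ f → e' ⊆ g →
      ψ f e' = ψ g e') :
    ψ f e + ψ g e = ∑ h ∈ F, ∑ e' ∈ h.powersetCard 2, if v ∈ e' then ψ h e' else 0 := by
  rw [← sum_edges_sum_faces F (fun h e' => if v ∈ e' then ψ h e' else 0),
    Finset.sum_eq_single_of_mem e he]
  · simp [hve, hfil, Finset.sum_pair hfg]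
  · intro e' he' hne
    by_cases hve' : v ∈ e'
    · have hb : e' ∉ boundaryEdges F := fun hb =>
        hv (Finset.mem_sup.2 ⟨e', hb, hve'⟩)
      obtain ⟨f', hf', g', hg', hfg', hi, hfil'⟩ := hF.exists_faces he' hb
      rw [hfil', Finset.sum_pair hfg', if_pos hve', if_pos hve',
        hψ e' he' hve' hne f' hf' g' hg' (hi ▸ Finset.inter_subset_left)
          (hi ▸ Finset.inter_subset_right), CharTwo.add_self_eq_zero]
    · simp [hve']

lemma IsSurfaceWithBoundary.even_card_star {F : Finset (Finset V)} (hF : IsSurfaceWithBoundary F)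
    {v : V} (hv : v ∉ boundaryVertices F) (heven : Even (degree F v)) :
    Even (F.filter (fun f => v ∈ f)).card := by
  have h := sum_edges_sum_faces F (fun _ e => if v ∈ e then 1 else 0)
  have h1 : ∑ e ∈ edges F, ∑ f ∈ F with e ⊆ f, (if v ∈ e then 1 else 0) = 2 * degree F v := by
    rw [degree, Finset.card_filter, Finset.mul_sum]
    refine Finset.sum_congr rfl fun e he => ?_
    by_cases hve : v ∈ e
    · have hb : e ∉ boundaryEdges F := fun hb => hv (Finset.mem_sup.2 ⟨e, hb, hve⟩)
      obtain ⟨f, _, g, _, hfg, _, hfil⟩ := hF.exists_faces he hb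
      simp [hve, hfil, Finset.card_pair hfg]
    · simp [hve]
  have h2 : ∑ f ∈ F, ∑ e ∈ f.powersetCard 2, (if v ∈ e then 1 else 0) =
      2 * (F.filter (fun f => v ∈ f)).card := by
    rw [Finset.card_filter, Finset.mul_sum]
    refine Finset.sum_congr rfl fun f hf => ?_
    by_cases hvf : v ∈ f
    · obtain ⟨x, y, hx, hy, hxy, rfl⟩ := exists_eq_insert_pair (hF.2.1 f hf) hvf
      rw [sum_powersetCard_two hx hy hxy]
      simp [hx, hy]
    · rw [if_neg hvf]
      refine Finset.sum_eq_zero fun e he => if_neg fun hve => hvf ?_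
      exact (Finset.mem_powersetCard.1 he).1 hve
  rw [h1, h2] at h
  rwa [← Nat.eq_of_mul_eq_mul_left two_pos h]

lemma exists_separating_fin_three : ∀ k : Fin 3, ∃ τ : Fin 3 → ZMod 2,
    ∀ a b : Fin 3, a ≠ k → b ≠ k → (τ a = τ b ↔ a = b) := by
  intro k
  refine ⟨fun a => if a = k + 1 then 1 else 0, ?_⟩
  revert k
  decide

lemma zmod_two_add_eq_one : ∀ {a b : ZMod 2}, a ≠ b → a + b = 1 := by
  decide

/-- Around an interior vertex of even degree, agreement cannot fail along exactly one edge. -/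
lemma IsSurfaceWithBoundary.agree_of_agree_star {F : Finset (Finset V)}
    (hF : IsSurfaceWithBoundary F) {c : Finset V → V → Fin 3} (hc : ∀ f ∈ F, Set.InjOn (c f) f)
    {v : V} (hv : v ∉ boundaryVertices F) (heven : Even (degree F v)) {e : Finset V}
    (he : e ∈ edges F) (hve : v ∈ e)
    (hag : ∀ e' ∈ edges F, v ∈ e' → e' ≠ e → Agree F c e') : Agree F c e := by
  have hb : e ∉ boundaryEdges F := fun hb => hv (Finset.mem_sup.2 ⟨e, hb, hve⟩)
  obtain ⟨f, hf, g, hg, hfg, hi, hfil⟩ := hF.exists_faces he hb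
  obtain ⟨_, _, _, he2⟩ := mem_edges.1 he
  have hef : e ⊆ f := hi ▸ Finset.inter_subset_left
  have heg : e ⊆ g := hi ▸ Finset.inter_subset_right
  have hcv : c g v = c f v := by
    have h := hF.sum_star hv he hve hfg hfil (fun h _ => if c h v = c f v then 1 else 0) (by
      intro e' he' hve' hne h hh k hk heh hek
      simp only [hag e' he' hve' hne h hh k hk heh hek v hve'])
    rw [Finset.sum_eq_zero] at h
    · by_contra hne
      simp [hne] at h
    · intro h hh
      by_cases hvh : v ∈ h
      · obtain ⟨x, y, hx, hy, hxy, rfl⟩ := exists_eq_insert_pair (hF.2.1 h hh) hvh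
        rw [sum_powersetCard_two hx hy hxy]
        simp [hx, hy, CharTwo.add_self_eq_zero]
      · refine Finset.sum_eq_zero fun e' he' => if_neg fun hve' => hvh ?_
        exact (Finset.mem_powersetCard.1 he').1 hve'
  have hface : ∀ h ∈ F, e ⊆ h → h = f ∨ h = g := by
    intro h hh heh
    have : h ∈ F.filter (fun h => e ⊆ h) := Finset.mem_filter.2 ⟨hh, heh⟩
    simpa [hfil] using this
  have hall : ∀ h ∈ F, v ∈ h → c h v = c f v := by
    intro h hh hvh
    by_contra hne
    obtain ⟨x, y, ⟨hx, hy, hvx, hvy, hxy⟩, h1, h2⟩ :=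
      exists_step (S := fun h => c h v = c f v) (hF.2.2.2 v f hf h hh (hef hve) hvh) rfl hne
    refine h2 ?_
    by_cases hxe : x ∩ y = e
    · rcases hface y hy (hxe ▸ Finset.inter_subset_right) with rfl | rfl
      · rfl
      · exact hcv
    · rw [← h1]
      exact hag _ (mem_edges.2 ⟨x, hx, Finset.inter_subset_left, hxy⟩) (by simp [hvx, hvy]) hxe
        y hy x hx Finset.inter_subset_right Finset.inter_subset_left v (by simp [hvx, hvy])
  obtain ⟨τ, hτ⟩ := exists_separating_fin_three (c f v)
  have hcne : ∀ h ∈ F, v ∈ h → ∀ u ∈ h, v ≠ u → c h u ≠ c f v := by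
    intro h hh hvh u hu hvu
    rw [← hall h hh hvh]
    exact (hc h hh).ne hu hvh hvu.symm
  have hsum := hF.sum_star hv he hve hfg hfil (fun h e' => ∑ u ∈ e'.erase v, τ (c h u)) (by
    intro e' he' hve' hne h hh k hk heh hek
    refine Finset.sum_congr rfl fun u hu => ?_
    rw [hag e' he' hve' hne h hh k hk heh hek u (Finset.mem_of_mem_erase hu)])
  have hzero : ∑ h ∈ F, ∑ e' ∈ h.powersetCard 2,
      (if v ∈ e' then ∑ u ∈ e'.erase v, τ (c h u) else 0) = 0 := by
    trans ∑ h ∈ F, if v ∈ h then (1 : ZMod 2) else 0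
    · refine Finset.sum_congr rfl fun h hh => ?_
      by_cases hvh : v ∈ h
      · have hinj := hc h hh
        have hcne' := hcne h hh hvh
        obtain ⟨x, y, hx, hy, hxy, rfl⟩ := exists_eq_insert_pair (hF.2.1 h hh) hvh
        have hne : τ (c {v, x, y} x) ≠ τ (c {v, x, y} y) := fun h => by
          rw [hτ _ _ (hcne' x (by simp) hx) (hcne' y (by simp) hy)] at h
          exact hxy (hinj (by simp) (by simp) h)
        rw [sum_powersetCard_two hx hy hxy]
        simpa [hx, hy] using zmod_two_add_eq_one hne
      · rw [if_neg hvh]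
        refine Finset.sum_eq_zero fun e' he' => if_neg fun hve' => hvh ?_
        exact (Finset.mem_powersetCard.1 he').1 hve'
    · rw [Finset.sum_boole]
      exact (ZMod.natCast_eq_zero_iff_even).2 (hF.even_card_star hv heven)
  rw [hzero] at hsum
  obtain ⟨w, hw⟩ := Finset.card_eq_one.1
    (show (e.erase v).card = 1 by rw [Finset.card_erase_of_mem hve, he2])
  have hwe : w ∈ e.erase v := by simp [hw]
  rw [Finset.mem_erase] at hwe
  simp only [hw, Finset.sum_singleton, CharTwo.add_eq_zero] at hsum
  rw [hτ _ _ (hcne f hf (hef hve) w (hef hwe.2) hwe.1.symm)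
    (hcne g hg (heg hve) w (heg hwe.2) hwe.1.symm)] at hsum
  have key : ∀ u ∈ e, c f u = c g u := by
    intro u hu
    by_cases huv : u = v
    · rw [huv, hcv]
    · have : u ∈ e.erase v := Finset.mem_erase.2 ⟨huv, hu⟩
      rw [hw, Finset.mem_singleton] at this
      rw [this, hsum]
  intro h hh k hk heh hek u hu
  rcases hface h hh heh with rfl | rfl <;> rcases hface k hk hek with rfl | rfl <;>
    simp [key u hu]

lemma IsSurfaceWithBoundary.sum_single_edge {F : Finset (Finset V)}
    (hF : IsSurfaceWithBoundary F) {f g : Finset V} (hf : f ∈ F) (hg : g ∈ F)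
    (h : (f ∩ g).card = 2) {k : Finset V} (hk : k ∈ F) :
    ∑ e ∈ k.powersetCard 2, (if e = f ∩ g then (1 : ZMod 2) else 0) =
      (if k = f then 1 else 0) + (if k = g then 1 else 0) := by
  have hne := hF.ne_of_card_inter hf h
  have hiff : f ∩ g ⊆ k ↔ k = f ∨ k = g := by
    have : k ∈ F.filter (fun h => f ∩ g ⊆ h) ↔ k = f ∨ k = g := by
      rw [hF.filter_inter hf hg h]
      simp
    simpa [hk] using this
  rw [Finset.sum_ite_eq']
  by_cases h1 : k = f
  · simp [Finset.mem_powersetCard, h, h1, hne]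
  · by_cases h2 : k = g
    · simp [Finset.mem_powersetCard, h, h2, hne.symm]
    · simp [Finset.mem_powersetCard, hiff, h1, h2]

lemma sum_single_boundary_edge {F : Finset (Finset V)} {e f : Finset V}
    (he : e ∈ boundaryEdges F) (hf : f ∈ F) (hef : e ⊆ f) {k : Finset V} (hk : k ∈ F) :
    ∑ e' ∈ k.powersetCard 2, (if e' = e then (1 : ZMod 2) else 0) = if k = f then 1 else 0 := by
  obtain ⟨he, h1⟩ := Finset.mem_filter.1 he
  obtain ⟨_, _, _, he2⟩ := mem_edges.1 he
  obtain ⟨a, ha⟩ := Finset.card_eq_one.1 h1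
  have hfa : f ∈ F.filter (fun f => e ⊆ f) := by simp [hf, hef]
  have hiff : e ⊆ k ↔ k = f := by
    have : k ∈ F.filter (fun h => e ⊆ h) ↔ k = f := by
      rw [ha, Finset.mem_singleton] at *
      rw [hfa]
    simpa [hk] using this
  simp [Finset.mem_powersetCard, he2, hiff]

/-- If agreement along edges connects all faces, any two faces are the boundary of a 1-cochain
supported on interior edges of agreement. -/
lemma IsSurfaceWithBoundary.exists_chain {F : Finset (Finset V)} (hF : IsSurfaceWithBoundary F)
    {c : Finset V → V → Fin 3}
    (hc : ∀ S : Finset V → Prop,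
        (∀ f ∈ F, ∀ g ∈ F, (f ∩ g).card = 2 → Agree F c (f ∩ g) → S f → S g) →
        ∀ f ∈ F, ∀ g ∈ F, S f → S g)
    {f g : Finset V} (hf : f ∈ F) (hg : g ∈ F) :
    ∃ x : Finset V → ZMod 2, (∀ e, x e ≠ 0 → e ∉ boundaryEdges F ∧ Agree F c e) ∧
      ∀ k ∈ F, ∑ e ∈ k.powersetCard 2, x e =
        (if k = f then 1 else 0) + (if k = g then 1 else 0) := by
  refine hc (fun g => ∃ x : Finset V → ZMod 2,
    (∀ e, x e ≠ 0 → e ∉ boundaryEdges F ∧ Agree F c e) ∧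
      ∀ k ∈ F, ∑ e ∈ k.powersetCard 2, x e =
        (if k = f then 1 else 0) + (if k = g then 1 else 0)) ?_ f hf g hg ?_
  · rintro g hg h hh hgh hag ⟨x, hx, hxs⟩
    refine ⟨fun e => x e + if e = g ∩ h then 1 else 0, fun e he => ?_, fun k hk => ?_⟩
    · by_cases hxe : x e = 0
      · have : e = g ∩ h := by
          by_contra hne
          simp [hxe, hne] at he
        subst this
        refine ⟨fun hb => ?_, hag⟩
        have h1 := (Finset.mem_filter.1 hb).2
        rw [hF.filter_inter hg hh hgh, Finset.card_pair (hF.ne_of_card_inter hg hgh)] at h1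
        omega
      · exact hx e hxe
    · rw [Finset.sum_add_distrib, hxs k hk, hF.sum_single_edge hg hh hgh hk]
      rw [add_assoc, ← add_assoc (if k = g then (1 : ZMod 2) else 0), CharTwo.add_self_eq_zero,
        zero_add]
  · exact ⟨0, by simp, fun k _ => by simp [CharTwo.add_self_eq_zero]⟩

lemma eq_of_edgewise_eq {F : Finset (Finset V)}
    (hconn : FacesConnected F) {α : Type*} {A : V → α}
    (hA : ∀ u w, u ≠ w → {u, w} ∈ edges F → A u = A w) {u w : V} (hu : u ∈ vertices F)
    (hw : w ∈ vertices F) : A u = A w := by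
  obtain ⟨f, hf, huf⟩ := Finset.mem_sup.1 hu
  obtain ⟨g, hg, hwg⟩ := Finset.mem_sup.1 hw
  have hface : ∀ f ∈ F, ∀ p ∈ f, ∀ q ∈ f, A p = A q := by
    intro f hf p hp q hq
    by_cases hpq : p = q
    · rw [hpq]
    · refine hA p q hpq (mem_edges.2 ⟨f, hf, ?_, Finset.card_pair hpq⟩)
      simp [Finset.insert_subset_iff, hp, hq]
  by_contra hne
  obtain ⟨x, y, ⟨hx, hy, hxy⟩, h1, h2⟩ :=
    exists_step (S := fun h => ∀ p ∈ h, A p = A u) (hconn f hf g hg)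
      (fun p hp => hface f hf p hp u huf) (fun h => hne (h w hwg).symm)
  obtain ⟨q, hq⟩ := Finset.card_pos.1 (hxy ▸ two_pos)
  rw [Finset.mem_inter] at hq
  exact h2 fun p hp => (hface y hy p hp q hq.2).trans (h1 q hq.1)

/-- The coboundary of vertex functions modulo two. -/
def vertexCoboundary (F : Finset (Finset V)) :
    (vertices F → ZMod 2) →ₗ[ZMod 2] (edges F → ZMod 2) :=
  Matrix.mulVecLin (Matrix.of fun e v => if v.1 ∈ e.1 then 1 else 0)

/-- The coboundary of edge functions modulo two. -/
def edgeCoboundary (F : Finset (Finset V)) : (edges F → ZMod 2) →ₗ[ZMod 2] (F → ZMod 2) :=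
  Matrix.mulVecLin (Matrix.of fun f e => if e.1 ⊆ f.1 then 1 else 0)

lemma vertexCoboundary_apply (F : Finset (Finset V)) (A : V → ZMod 2) (e : edges F) :
    vertexCoboundary F (fun v => A v) e = ∑ v ∈ e.1, A v := by
  obtain ⟨f, hf, hef, _⟩ := mem_edges.1 e.2
  have hsub : e.1 ⊆ vertices F := fun v hv => Finset.mem_sup.2 ⟨f, hf, hef hv⟩
  simp only [vertexCoboundary, Matrix.mulVecLin_apply, Matrix.mulVec, dotProduct, Matrix.of_apply,
    ite_mul, one_mul, zero_mul]
  rw [Finset.sum_coe_sort (vertices F) (fun v => if v ∈ e.1 then A v else 0), ← Finset.sum_filter,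
    Finset.filter_mem_eq_inter, Finset.inter_eq_right.2 hsub]

lemma edgeCoboundary_apply (F : Finset (Finset V)) (x : Finset V → ZMod 2) (f : F) :
    edgeCoboundary F (fun e => x e) f = ∑ e ∈ f.1.powersetCard 2, x e := by
  simp only [edgeCoboundary, Matrix.mulVecLin_apply, Matrix.mulVec, dotProduct, Matrix.of_apply,
    ite_mul, one_mul, zero_mul]
  rw [Finset.sum_coe_sort (edges F) (fun e => if e ⊆ f.1 then x e else 0), ← Finset.sum_filter]
  refine Finset.sum_congr ?_ fun _ _ => rfl
  ext e
  simp only [Finset.mem_filter, mem_edges, Finset.mem_powersetCard]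
  exact ⟨fun ⟨⟨_, _, _, h⟩, h'⟩ => ⟨h', h⟩, fun ⟨h', h⟩ => ⟨⟨f, f.2, h', h⟩, h'⟩⟩

lemma exists_extension (s : Finset V) (A : s → ZMod 2) : ∃ B : V → ZMod 2, A = fun v : s => B v :=
  ⟨fun v => if h : v ∈ s then A ⟨v, h⟩ else 0, by ext v; simp⟩

lemma sum_edges_sum_vertices {f : Finset V} (hf : f.card = 3) (A : V → ZMod 2) :
    ∑ e ∈ f.powersetCard 2, ∑ v ∈ e, A v = 0 := by
  obtain ⟨x, hx⟩ := Finset.card_pos.1 (hf ▸ three_pos)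
  obtain ⟨y, z, hxy, hxz, hyz, rfl⟩ := exists_eq_insert_pair hf hx
  rw [sum_powersetCard_two hxy hxz hyz, Finset.sum_pair hxy, Finset.sum_pair hxz,
    Finset.sum_pair hyz]
  linear_combination (A x + A y + A z) * CharTwo.two_eq_zero (R := ZMod 2)

/-- The first cohomology modulo two of a simply connected surface vanishes. -/
lemma IsSimplyConnectedSurface.exists_sum_eq {F : Finset (Finset V)}
    (hF : IsSimplyConnectedSurface F) {x : Finset V → ZMod 2}
    (hx : ∀ f ∈ F, ∑ e ∈ f.powersetCard 2, x e = 0) :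
    ∃ A : V → ZMod 2, ∀ e ∈ edges F, x e = ∑ v ∈ e, A v := by
  obtain ⟨hS, hconn, hχ⟩ := hF
  have hker : Module.finrank (ZMod 2) (LinearMap.ker (vertexCoboundary F)) ≤ 1 := by
    refine (Submodule.finrank_mono (t := Submodule.span (ZMod 2) {1}) ?_).trans
      ((finrank_span_le_card _).trans (by simp))
    intro A hA
    obtain ⟨B, rfl⟩ := exists_extension _ A
    obtain ⟨f, hf⟩ := hS.1
    obtain ⟨a, ha⟩ := Finset.card_pos.1 ((hS.2.1 f hf).symm ▸ three_pos)
    have hav : a ∈ vertices F := Finset.mem_sup.2 ⟨f, hf, ha⟩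
    refine Submodule.mem_span_singleton.2 ⟨B a, ?_⟩
    ext v
    have := eq_of_edgewise_eq hconn (A := B) (fun u w huw he => by
      have := congrFun (LinearMap.mem_ker.1 hA) ⟨_, he⟩
      rw [vertexCoboundary_apply, Finset.sum_pair huw] at this
      exact CharTwo.add_eq_zero.1 this) hav v.2
    simp [this]
  have hpair : ∀ f g : F, Pi.single f 1 + Pi.single g 1 ∈ LinearMap.range (edgeCoboundary F) := by
    intro f g
    obtain ⟨c, -, hc⟩ := hS.exists_face_colorings hconn
    obtain ⟨x, -, hx⟩ := hS.exists_chain hc f.2 g.2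
    refine ⟨fun e => x e, ?_⟩
    ext k
    rw [edgeCoboundary_apply, hx k k.2]
    simp only [Pi.add_apply, Pi.single_apply, Subtype.ext_iff]
  have hspan : ∀ (U : Submodule (ZMod 2) (F → ZMod 2)) (f : F),
      LinearMap.range (edgeCoboundary F) ≤ U → Pi.single f 1 ∈ U → U = ⊤ := by
    intro U f hU hf
    rw [eq_top_iff, ← (Pi.basisFun (ZMod 2) F).span_eq, Submodule.span_le]
    rintro _ ⟨g, rfl⟩
    have := U.sub_mem (hU (hpair g f)) hf
    simpa using this
  have hrange : F.card ≤ Module.finrank (ZMod 2) (LinearMap.range (edgeCoboundary F)) + 1 := by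
    obtain ⟨f, hf⟩ := hS.1
    have htop := hspan (LinearMap.range (edgeCoboundary F) ⊔
      Submodule.span (ZMod 2) {Pi.single ⟨f, hf⟩ 1}) ⟨f, hf⟩ le_sup_left
      (Submodule.mem_sup_right (Submodule.mem_span_singleton_self _))
    have h := Submodule.finrank_add_le_finrank_add_finrank (LinearMap.range (edgeCoboundary F))
      (Submodule.span (ZMod 2) {Pi.single ⟨f, hf⟩ 1})
    rw [htop, finrank_top, Module.finrank_fintype_fun_eq_card, Fintype.card_coe] at h
    exact h.trans (by gcongr; exact (finrank_span_le_card _).trans (by simp))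
  have hrange' : (boundaryEdges F).Nonempty →
      F.card ≤ Module.finrank (ZMod 2) (LinearMap.range (edgeCoboundary F)) := by
    rintro ⟨e, he⟩
    obtain ⟨f, hf, hef, _⟩ := mem_edges.1 (Finset.mem_filter.1 he).1
    have htop := hspan _ ⟨f, hf⟩ le_rfl ⟨fun e' => if e'.1 = e then 1 else 0, by
      ext k
      rw [edgeCoboundary_apply F (fun e' => if e' = e then 1 else 0),
        sum_single_boundary_edge he hf hef k.2]
      simp [Pi.single_apply, Subtype.ext_iff]⟩
    rw [htop, finrank_top, Module.finrank_fintype_fun_eq_card, Fintype.card_coe]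
  have hle : LinearMap.range (vertexCoboundary F) ≤ LinearMap.ker (edgeCoboundary F) := by
    rintro _ ⟨A, rfl⟩
    obtain ⟨B, rfl⟩ := exists_extension _ A
    rw [LinearMap.mem_ker, funext (vertexCoboundary_apply F B)]
    ext k
    rw [edgeCoboundary_apply F (fun e => ∑ v ∈ e, B v), sum_edges_sum_vertices (hS.2.1 k k.2)]
    rfl
  have h0 := LinearMap.finrank_range_add_finrank_ker (vertexCoboundary F)
  have h1 := LinearMap.finrank_range_add_finrank_ker (edgeCoboundary F)
  rw [Module.finrank_fintype_fun_eq_card, Fintype.card_coe] at h0 h1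
  have heq := Submodule.eq_of_le_of_finrank_le hle (by
    rw [eulerChar] at hχ
    rcases hχ with h | ⟨h, hb⟩
    · omega
    · have := hrange' hb
      omega)
  have hxk : (fun e : edges F => x e) ∈ LinearMap.ker (edgeCoboundary F) := by
    rw [LinearMap.mem_ker]
    ext k
    rw [edgeCoboundary_apply, hx k k.2]
    rfl
  rw [← heq] at hxk
  obtain ⟨A, hA⟩ := hxk
  obtain ⟨B, rfl⟩ := exists_extension _ A
  exact ⟨B, fun e he => by rw [← vertexCoboundary_apply F B ⟨e, he⟩, hA]⟩

lemma IsSurfaceWithBoundary.sum_boundaryEdges {F : Finset (Finset V)}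
    (hF : IsSurfaceWithBoundary F) (A : V → ZMod 2) :
    ∑ e ∈ boundaryEdges F, ∑ v ∈ e, A v = 0 := by
  have h := sum_edges_sum_faces F (fun _ e => ∑ v ∈ e, A v)
  rw [Finset.sum_eq_zero fun f hf => sum_edges_sum_vertices (hF.2.1 f hf) A] at h
  rw [boundaryEdges, Finset.sum_filter]
  refine (Finset.sum_congr rfl fun e he => ?_).trans h
  rw [Finset.sum_const]
  rcases hF.2.2.1 e he with h | h
  · simp [h]
  · rw [if_neg (by omega), h, two_nsmul, CharTwo.add_self_eq_zero]

/-- An edge of disagreement is crossed by a cut that crosses no other edge of disagreement and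
no boundary edge. -/
lemma IsSimplyConnectedSurface.exists_cut {F : Finset (Finset V)}
    (hF : IsSimplyConnectedSurface F) {c : Finset V → V → Fin 3}
    (hc : ∀ S : Finset V → Prop,
        (∀ f ∈ F, ∀ g ∈ F, (f ∩ g).card = 2 → Agree F c (f ∩ g) → S f → S g) →
        ∀ f ∈ F, ∀ g ∈ F, S f → S g)
    {e : Finset V} (he : e ∈ edges F) (hbad : ¬ Agree F c e) :
    ∃ A : V → ZMod 2, ∀ e' ∈ edges F, (¬ Agree F c e' ∨ e' ∈ boundaryEdges F) →
      ∑ v ∈ e', A v = if e' = e then 1 else 0 := by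
  obtain ⟨f, hf, g, hg, hfg, rfl, -⟩ :=
    hF.1.exists_faces he (fun hb => hbad (agree_of_mem_boundaryEdges c hb))
  obtain ⟨_, _, _, h2⟩ := mem_edges.1 he
  obtain ⟨x, hx, hxs⟩ := hF.1.exists_chain hc hf hg
  obtain ⟨A, hA⟩ := hF.exists_sum_eq (x := fun e' => x e' + if e' = f ∩ g then 1 else 0) (by
    intro k hk
    rw [Finset.sum_add_distrib, hxs k hk, hF.1.sum_single_edge hf hg h2 hk,
      CharTwo.add_self_eq_zero])
  refine ⟨A, fun e' he' h => ?_⟩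
  have hx0 : x e' = 0 := by
    by_contra hne
    have := hx e' hne
    tauto
  rw [← hA e' he', hx0, zero_add]

/-- Two boundary edges are crossed by a cut that crosses no other boundary edge. -/
lemma IsSimplyConnectedSurface.exists_boundary_cut {F : Finset (Finset V)}
    (hF : IsSimplyConnectedSurface F) {e e₀ : Finset V} (he : e ∈ boundaryEdges F)
    (he₀ : e₀ ∈ boundaryEdges F) :
    ∃ A : V → ZMod 2, ∀ e' ∈ boundaryEdges F,
      ∑ v ∈ e', A v = (if e' = e then 1 else 0) + if e' = e₀ then 1 else 0 := by
  obtain ⟨c, -, hc⟩ := hF.1.exists_face_colorings hF.2.1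
  obtain ⟨f, hf, hef, _⟩ := mem_edges.1 (Finset.mem_filter.1 he).1
  obtain ⟨g, hg, heg, _⟩ := mem_edges.1 (Finset.mem_filter.1 he₀).1
  obtain ⟨x, hx, hxs⟩ := hF.1.exists_chain hc hf hg
  obtain ⟨A, hA⟩ := hF.exists_sum_eq
    (x := fun e' => x e' + ((if e' = e then 1 else 0) + if e' = e₀ then 1 else 0)) (by
    intro k hk
    rw [Finset.sum_add_distrib, hxs k hk, Finset.sum_add_distrib,
      sum_single_boundary_edge he hf hef hk, sum_single_boundary_edge he₀ hg heg hk,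
      CharTwo.add_self_eq_zero])
  refine ⟨A, fun e' he' => ?_⟩
  have hx0 : x e' = 0 := by
    by_contra hne
    exact (hx e' hne).1 he'
  rw [← hA e' (Finset.mem_filter.1 he').1, hx0, zero_add]

/-- A cut avoiding the boundary with a boundary vertex on one side has the whole boundary on
that side. -/
lemma IsSimplyConnectedSurface.eq_zero_of_mem_boundaryVertices {F : Finset (Finset V)}
    (hF : IsSimplyConnectedSurface F) {A : V → ZMod 2}
    (hA : ∀ e ∈ boundaryEdges F, ∑ v ∈ e, A v = 0) {a w : V} (ha : a ∈ boundaryVertices F)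
    (hAa : A a = 0) (hw : w ∈ boundaryVertices F) : A w = 0 := by
  have hconst : ∀ e ∈ boundaryEdges F, ∀ u ∈ e, ∀ v ∈ e, A u = A v := by
    intro e he u hu v hv
    obtain ⟨_, _, _, h2⟩ := mem_edges.1 (Finset.mem_filter.1 he).1
    obtain ⟨p, q, hpq, rfl⟩ := Finset.card_eq_two.1 h2
    have h := hA _ he
    rw [Finset.sum_pair hpq, CharTwo.add_eq_zero] at h
    grind
  obtain ⟨e₀, he₀, ha₀⟩ := Finset.mem_sup.1 ha
  obtain ⟨e, he, hwe⟩ := Finset.mem_sup.1 hw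
  obtain ⟨B, hB⟩ := hF.exists_boundary_cut he he₀
  have h := hF.1.sum_boundaryEdges (fun v => A v * B v)
  rw [Finset.sum_eq_single_of_mem e he] at h
  · by_cases hee : e = e₀
    · subst hee
      rw [hconst e he w hwe a ha₀, hAa]
    · rw [Finset.sum_congr rfl fun v hv => by rw [hconst e he v hv w hwe], ← Finset.mul_sum,
        hB e he] at h
      simpa [hee] using h
  · intro e' he' hne
    by_cases hee : e' = e₀
    · subst hee
      exact Finset.sum_eq_zero fun v hv => by rw [hconst e' he' v hv a ha₀, hAa, zero_mul]
    · obtain ⟨_, _, _, h2⟩ := mem_edges.1 (Finset.mem_filter.1 he').1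
      obtain ⟨p, hp⟩ := Finset.card_pos.1 (h2 ▸ two_pos)
      rw [Finset.sum_congr rfl fun v hv => by rw [hconst e' he' v hv p hp], ← Finset.mul_sum,
        hB e' he']
      simp [hne, hee]

lemma zmod_two_eq_one : ∀ {a : ZMod 2}, a ≠ 0 → a = 1 := by
  decide

/-- Complementing a cut if necessary, a given vertex lies on its zero side. -/
lemma exists_cut_eq_zero (F : Finset (Finset V)) (B : V → ZMod 2) (a : V) :
    ∃ B' : V → ZMod 2, B' a = 0 ∧ ∀ e ∈ edges F, ∑ v ∈ e, B' v = ∑ v ∈ e, B v := by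
  refine ⟨fun v => B v + B a, CharTwo.add_self_eq_zero _, fun e he => ?_⟩
  obtain ⟨_, _, _, h2⟩ := mem_edges.1 he
  rw [Finset.sum_add_distrib, Finset.sum_const, h2, two_nsmul, CharTwo.add_self_eq_zero, add_zero]

/-- A minimal cut isolates an interior vertex on exactly one edge of disagreement; hence there
is no disagreement at all. -/
lemma IsSimplyConnectedSurface.agree {F : Finset (Finset V)}
    (hF : IsSimplyConnectedSurface F)
    (heven : ∀ v ∈ vertices F, v ∉ boundaryVertices F → Even (degree F v))
    {c : Finset V → V → Fin 3} (hinj : ∀ f ∈ F, Set.InjOn (c f) f)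
    (hc : ∀ S : Finset V → Prop,
        (∀ f ∈ F, ∀ g ∈ F, (f ∩ g).card = 2 → Agree F c (f ∩ g) → S f → S g) →
        ∀ f ∈ F, ∀ g ∈ F, S f → S g)
    {e : Finset V} (he : e ∈ edges F) : Agree F c e := by
  classical
  by_contra hbad
  obtain ⟨a, ha⟩ : ∃ a, (boundaryVertices F).Nonempty → a ∈ boundaryVertices F := by
    by_cases h : (boundaryVertices F).Nonempty
    · exact ⟨h.choose, fun _ => h.choose_spec⟩
    · obtain ⟨_, _, _, h2⟩ := mem_edges.1 he
      obtain ⟨a, -⟩ := Finset.card_pos.1 (h2 ▸ two_pos)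
      exact ⟨a, fun h' => absurd h' h⟩
  let IsCut : (V → ZMod 2) → Finset V → Prop := fun A e =>
    A a = 0 ∧ ∀ e' ∈ edges F, (¬ Agree F c e' ∨ e' ∈ boundaryEdges F) →
      ∑ v ∈ e', A v = if e' = e then 1 else 0
  have hne : {A | ∃ e ∈ edges F, ¬ Agree F c e ∧ IsCut A e}.Nonempty := by
    obtain ⟨B, hB⟩ := hF.exists_cut hc he hbad
    obtain ⟨A, hAa, hA⟩ := exists_cut_eq_zero F B a
    exact ⟨A, e, he, hbad, hAa, fun e' he' h => by rw [hA e' he', hB e' he' h]⟩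
  obtain ⟨A, ⟨e, he, hbad, hAa, hA⟩, hmin⟩ :=
    (measure fun A : V → ZMod 2 => ((vertices F).filter (fun v => A v ≠ 0)).card).wf.has_min _ hne
  obtain ⟨f, hf, hef, h2⟩ := mem_edges.1 he
  obtain ⟨v, w, hvw, hevw, hAv, hAw⟩ : ∃ v w, v ≠ w ∧ e = {v, w} ∧ A v = 1 ∧ A w = 0 := by
    obtain ⟨p, q, hpq, rfl⟩ := Finset.card_eq_two.1 h2
    have h := hA _ he (Or.inl hbad)
    rw [Finset.sum_pair hpq, if_pos rfl] at h
    by_cases hp : A p = 0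
    · refine ⟨q, p, hpq.symm, Finset.pair_comm p q, ?_, hp⟩
      rwa [hp, zero_add] at h
    · have hp := zmod_two_eq_one hp
      refine ⟨p, q, hpq, rfl, hp, ?_⟩
      rw [hp] at h
      simpa using h
  have hve : v ∈ e := by simp [hevw]
  have hvV : v ∈ vertices F := Finset.mem_sup.2 ⟨f, hf, hef hve⟩
  have hvb : v ∉ boundaryVertices F := by
    intro hvb
    have := hF.eq_zero_of_mem_boundaryVertices (A := A) (fun e' he' => by
      rw [hA e' (Finset.mem_filter.1 he').1 (Or.inr he'), if_neg]
      rintro rfl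
      exact hbad (agree_of_mem_boundaryEdges c he')) (ha ⟨v, hvb⟩) hAa hvb
    simp [hAv] at this
  refine hbad (hF.1.agree_of_agree_star hinj hvb (heven v hvV hvb) he hve ?_)
  intro e' he' hve' hne'
  by_contra hbad'
  obtain ⟨B₀, hB₀⟩ := hF.exists_cut hc he' hbad'
  obtain ⟨B, hBv, hB⟩ := exists_cut_eq_zero F B₀ v
  refine hmin (fun u => A u * B u) ⟨e', he', hbad', by simp [hAa], ?_⟩ (Finset.card_lt_card ?_)
  · intro k hk hkb
    by_cases hke : k = e
    · rw [if_neg (hke ▸ hne'.symm), hke, hevw, Finset.sum_pair hvw, hBv, hAw]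
      simp
    · have hAk := hA k hk hkb
      have hBk := hB k hk
      rw [hB₀ k hk hkb] at hBk
      rw [if_neg hke] at hAk
      obtain ⟨_, _, _, hk2⟩ := mem_edges.1 hk
      obtain ⟨p, q, hpq, rfl⟩ := Finset.card_eq_two.1 hk2
      rw [Finset.sum_pair hpq] at hAk hBk ⊢
      rw [CharTwo.add_eq_zero] at hAk
      rw [← hAk, ← mul_add, hBk]
      split_ifs with h
      · have : A p = 1 := by
          subst h
          rcases Finset.mem_insert.1 hve' with rfl | h
          · exact hAv
          · rw [Finset.mem_singleton] at h
            rw [hAk, ← h, hAv]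
        simp [this]
      · simp
  · refine (Finset.ssubset_iff_of_subset ?_).2 ⟨v, by simp [hvV, hAv], by simp [hBv]⟩
    intro u
    simp only [Finset.mem_filter]
    exact fun ⟨h, h'⟩ => ⟨h, left_ne_zero_of_mul h'⟩

end Fisk


open Fisk in
/-- A triangulation of a simply connected surface (possibly with boundary)
in which every interior vertex has even degree admits a proper 3-coloring of
its vertices. -/
theorem even_simply_connected_three_colorable {V : Type*} [DecidableEq V]
    (F : Finset (Finset V)) (hF : IsSimplyConnectedSurface F)
    (heven : ∀ v ∈ vertices F, v ∉ boundaryVertices F → Even (degree F v)) :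
    ∃ c : V → Fin 3, ProperColoring F c := by
  classical
  obtain ⟨c, hinj, hc⟩ := hF.1.exists_face_colorings hF.2.1
  have hag : ∀ e ∈ edges F, Agree F c e := fun e he => hF.agree heven hinj hc he
  have hall : ∀ v, ∀ f ∈ F, ∀ g ∈ F, v ∈ f → v ∈ g → c f v = c g v := by
    intro v f hf g hg hvf hvg
    by_contra hne
    obtain ⟨x, y, ⟨hx, hy, hvx, hvy, hxy⟩, h1, h2⟩ :=
      exists_step (S := fun h => c f v = c h v) (hF.1.2.2.2 v f hf g hg hvf hvg) rfl hne
    exact h2 (h1.trans (hag _ (mem_edges.2 ⟨x, hx, Finset.inter_subset_left, hxy⟩) x hx y hy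
      Finset.inter_subset_left Finset.inter_subset_right v (by simp [hvx, hvy])))
  have hface : ∀ v, ∃ g, ∀ f ∈ F, v ∈ f → g ∈ F ∧ v ∈ g := by
    intro v
    by_cases h : ∃ g ∈ F, v ∈ g
    · obtain ⟨g, hg⟩ := h
      exact ⟨g, fun _ _ _ => hg⟩
    · exact ⟨∅, fun f hf hv => absurd ⟨f, hf, hv⟩ h⟩
  choose g hg using hface
  refine ⟨fun v => c (g v) v, fun e he u hu w hw huw => ?_⟩
  obtain ⟨f, hf, hef, -⟩ := mem_edges.1 he
  obtain ⟨hgu, hugu⟩ := hg u f hf (hef hu)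
  obtain ⟨hgw, hwgw⟩ := hg w f hf (hef hw)
  simp only [hall u (g u) hgu f hf hugu (hef hu), hall w (g w) hgw f hf hwgw (hef hw)]
  exact (hinj f hf).ne (hef hu) (hef hw) huw
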